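/- arXiv:2405.13149 — 2 statements merged into one kernel-verified Lean document; each statement's English description precedes it below -/
import Mathlib

section
/- Let η^y_0 be the system of conditional measures of η := φ_♯μ given F(z) = y, i.e. a Markov kernel y ↦ η^y_0 from ℝ^M to ℝ^N satisfying ∫_{ℝ^N} 1_B(z) 1_E(F(z)) η(dz) = ∫_E η^y_0(B) (F_♯η)(dy) for all Borel B ⊆ ℝ^N and E ⊆ ℝ^M. Then for G_♯μ-almost every y ∈ ℝ^M, the conditional measure decomposes as μ^y_0 = μ^φ ∗ (ϕᵀ)_♯ η^y_0. -/
open MeasureTheory ProbabilityTheory Filter Topology Metric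
open scoped ENNReal NNReal RealInnerProductSpace

noncomputable section

/-- A centered Gaussian measure on a Hilbert space: the pushforward under every
continuous linear functional is a centered real Gaussian. -/
def IsCenteredGaussian {X : Type*} [NormedAddCommGroup X] [InnerProductSpace ℝ X]
    [MeasurableSpace X] (μ : Measure X) : Prop :=
  ∀ f : X →L[ℝ] ℝ, ∃ v : ℝ≥0, μ.map f = gaussianReal 0 v

theorem IsCenteredGaussian.isGaussian {X : Type*} [NormedAddCommGroup X] [InnerProductSpace ℝ X]
    [MeasurableSpace X] [BorelSpace X] {μ : Measure X} (hμ : IsCenteredGaussian μ) :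
    IsGaussian μ :=
  isGaussian_of_map_eq_gaussianReal fun L => ⟨0, hμ L⟩

theorem IsCenteredGaussian.integral_dual_eq_zero {X : Type*} [NormedAddCommGroup X]
    [InnerProductSpace ℝ X] [MeasurableSpace X] [BorelSpace X] {μ : Measure X}
    (hμ : IsCenteredGaussian μ) (f : X →L[ℝ] ℝ) : ∫ u, f u ∂μ = 0 := by
  obtain ⟨v, hv⟩ := hμ f
  have h : ∫ t, t ∂(μ.map f) = ∫ u, f u ∂μ :=
    integral_map (by fun_prop) (by fun_prop)
  rw [← h, hv, integral_id_gaussianReal]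

/-- Two continuous linear images of a centered Gaussian vector are independent as soon as their
cross-covariance operator vanishes. -/
theorem IsCenteredGaussian.indepFun_of_comp_covariance_eq_zero
    {X E H : Type*} [NormedAddCommGroup X] [InnerProductSpace ℝ X] [CompleteSpace X]
    [SecondCountableTopology X] [MeasurableSpace X] [BorelSpace X]
    [NormedAddCommGroup E] [InnerProductSpace ℝ E] [CompleteSpace E]
    [SecondCountableTopology E] [MeasurableSpace E] [BorelSpace E]
    [NormedAddCommGroup H] [InnerProductSpace ℝ H] [CompleteSpace H]
    [SecondCountableTopology H] [MeasurableSpace H] [BorelSpace H]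
    {μ : Measure X} [IsProbabilityMeasure μ] (hμ : IsCenteredGaussian μ)
    {K : X →L[ℝ] X} (hK : ∀ f g : X, ⟪K f, g⟫ = ∫ u, ⟪f, u⟫ * ⟪g, u⟫ ∂μ)
    (A : X →L[ℝ] E) (B : X →L[ℝ] H)
    (hAB : ∀ y, A (K (ContinuousLinearMap.adjoint B y)) = 0) :
    IndepFun A B μ := by
  have := hμ.isGaussian
  have hid : HasGaussianLaw (fun u : X => u) μ := IsGaussian.hasGaussianLaw_id
  refine (hid.map_fun (A.prod B)).indepFun_of_covariance_inner fun x y => ?_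
  have hx : (fun u => ⟪x, A u⟫) = innerSL ℝ (ContinuousLinearMap.adjoint A x) := by
    ext u; simp [ContinuousLinearMap.adjoint_inner_left]
  have hy : (fun u => ⟪y, B u⟫) = innerSL ℝ (ContinuousLinearMap.adjoint B y) := by
    ext u; simp [ContinuousLinearMap.adjoint_inner_left]
  change cov[fun u => ⟪x, A u⟫, fun u => ⟪y, B u⟫; μ] = 0
  rw [hx, hy, covariance_eq_sub (IsGaussian.memLp_dual μ _ 2 (by simp))
    (IsGaussian.memLp_dual μ _ 2 (by simp)), hμ.integral_dual_eq_zero, zero_mul, sub_zero]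
  have h := hK (ContinuousLinearMap.adjoint B y) (ContinuousLinearMap.adjoint A x)
  rw [ContinuousLinearMap.adjoint_inner_right, hAB, inner_zero_left] at h
  rw [h]
  exact integral_congr_ae (.of_forall fun u => by simp [mul_comm])

/-- Conditioning the second factor of a product measure disintegrates the law of `x + T z`
into convolutions. -/
theorem prod_preimage_eq_lintegral_conv
    {X Z Y : Type*} [AddMonoid X] [MeasurableSpace X] [MeasurableAdd₂ X]
    [MeasurableSpace Z] [MeasurableSpace Y]
    (ρ : Measure X) [SFinite ρ] (η : Measure Z) [IsFiniteMeasure η]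
    {T : Z → X} (hT : Measurable T) {F : Z → Y} (hF : Measurable F)
    (κ : Kernel Y Z) [IsSFiniteKernel κ]
    (hκ : ∀ (B : Set Z) (E : Set Y), MeasurableSet B → MeasurableSet E →
      η (B ∩ F ⁻¹' E) = ∫⁻ y in E, κ y B ∂(η.map F))
    {A : Set X} (hA : MeasurableSet A) {E : Set Y} (hE : MeasurableSet E) :
    (ρ.prod η) {p | p.1 + T p.2 ∈ A ∧ F p.2 ∈ E}
      = ∫⁻ y in E, (ρ.conv ((κ y).map T)) A ∂(η.map F) := by
  have hS : MeasurableSet {p : X × Z | p.1 + T p.2 ∈ A} :=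
    (by fun_prop : Measurable fun p : X × Z => p.1 + T p.2) hA
  have hSE : MeasurableSet {p : X × Z | p.1 + T p.2 ∈ A ∧ F p.2 ∈ E} :=
    hS.inter ((hF.comp measurable_snd) hE)
  have hconv : ∀ y, (ρ.conv ((κ y).map T)) A = ∫⁻ x, κ y {z | x + T z ∈ A} ∂ρ := by
    intro y
    rw [Measure.conv, Measure.map_apply (by fun_prop) hA,
      Measure.prod_apply (measurable_add hA)]
    refine lintegral_congr fun x => ?_
    rw [Measure.map_apply hT (measurable_prodMk_left (measurable_add hA))]
    rfl
  have hmeas : Measurable fun p : Y × X => κ p.1 {z | p.2 + T z ∈ A} := by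
    have hS' : MeasurableSet {q : (Y × X) × Z | q.1.2 + T q.2 ∈ A} :=
      (by fun_prop : Measurable fun q : (Y × X) × Z => q.1.2 + T q.2) hA
    exact Kernel.measurable_kernel_prodMk_left (κ := κ.comap Prod.fst measurable_fst) hS'
  simp_rw [hconv]
  rw [Measure.prod_apply hSE, lintegral_lintegral_swap hmeas.aemeasurable]
  exact lintegral_congr fun x => hκ _ E (measurable_prodMk_left hS) hE

/-- Uniqueness of conditional measures: two Markov kernels with the same integrals over all
measurable rectangles agree almost everywhere. -/
theorem ae_eq_of_forall_setLIntegral_eq {X Y : Type*} [MeasurableSpace X]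
    [MeasurableSpace Y] [MeasurableSpace.CountableOrCountablyGenerated Y X]
    {ν : Measure Y} [IsFiniteMeasure ν] {κ κ' : Kernel Y X} [IsFiniteKernel κ] [IsFiniteKernel κ']
    (h : ∀ (A : Set X) (E : Set Y), MeasurableSet A → MeasurableSet E →
      ∫⁻ y in E, κ y A ∂ν = ∫⁻ y in E, κ' y A ∂ν) :
    κ =ᵐ[ν] κ' := by
  refine Kernel.ae_eq_of_compProd_eq (Measure.ext_prod fun {E A} hE hA => ?_)
  rw [Measure.compProd_apply_prod hE hA, Measure.compProd_apply_prod hE hA, h A E hA hE]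

/-- The interpolation `u ↦ ∑ i, φ i u • ∑ j, Θ⁻¹ i j • θ j` fixes every `θ k` when the Gram matrix
`Θ i j = φ i (θ j)` is symmetric and invertible. -/
theorem sub_sum_gramInv_smul_eq_zero {X : Type*} [AddCommGroup X] [Module ℝ X]
    {ι : Type*} [Fintype ι] [DecidableEq ι] (φ : ι → X → ℝ) (θ : ι → X) (Θ : Matrix ι ι ℝ)
    (hΘ : ∀ i j, Θ i j = φ i (θ j)) (hsymm : Θ.IsSymm) (hΘinv : IsUnit Θ.det) (k : ι) :
    θ k - ∑ i, φ i (θ k) • ∑ j, Θ⁻¹ i j • θ j = 0 := by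
  have h : ∀ j, ∑ i, Θ i k * Θ⁻¹ i j = (1 : Matrix ι ι ℝ) k j := fun j => by
    rw [← Matrix.mul_nonsing_inv Θ hΘinv, Matrix.mul_apply]
    exact Finset.sum_congr rfl fun i _ => by rw [hsymm.apply]
  simp_rw [← hΘ, Finset.smul_sum, smul_smul]
  rw [Finset.sum_comm]
  simp_rw [← Finset.sum_smul, h, Matrix.one_apply, ite_smul, one_smul, zero_smul]
  simp

theorem statement_4
    {X : Type*} [NormedAddCommGroup X] [InnerProductSpace ℝ X] [CompleteSpace X]
    [SecondCountableTopology X] [MeasurableSpace X] [BorelSpace X]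
    {N M : ℕ}
    (μ : Measure X) [IsProbabilityMeasure μ] (hμ : IsCenteredGaussian μ)
    (K : X →L[ℝ] X)
    (hK : ∀ f g : X, ⟪K f, g⟫ = ∫ u, ⟪f, u⟫ * ⟪g, u⟫ ∂μ)
    (φ : Fin N → (X →L[ℝ] ℝ))
    -- the map `φ = (φ₁, …, φ_N) : X → ℝ^N`
    (Φ : X → EuclideanSpace ℝ (Fin N))
    (hΦ : ∀ u i, Φ u i = φ i u)
    -- `θᵢ = K φᵢ*`, where `φᵢ*` is the Riesz representer of `φᵢ`
    (θ : Fin N → X)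
    (hθ : ∀ i, θ i = K ((InnerProductSpace.toDual ℝ X).symm (φ i)))
    -- the Gram matrix `Θᵢⱼ = φᵢ(K φⱼ*)`, assumed invertible
    (Θ : Matrix (Fin N) (Fin N) ℝ)
    (hΘdef : ∀ i j, Θ i j = φ i (θ j))
    (hΘinv : IsUnit Θ.det)
    -- the gamblets `ϕᵢ = Σⱼ (Θ⁻¹)ᵢⱼ θⱼ` and the reconstruction map `ϕᵀ`
    (ϕ : Fin N → X)
    (hϕ : ∀ i, ϕ i = ∑ j, Θ⁻¹ i j • θ j)
    (ϕT : EuclideanSpace ℝ (Fin N) → X)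
    (hϕT : ∀ z, ϕT z = ∑ i, z i • ϕ i)
    -- `F` is locally Lipschitz and `G = F ∘ φ`
    (F : EuclideanSpace ℝ (Fin N) → EuclideanSpace ℝ (Fin M))
    (hF : ∀ r > (0 : ℝ), ∃ L : ℝ≥0, LipschitzOnWith L F (ball 0 r))
    (G : X → EuclideanSpace ℝ (Fin M))
    (hG : ∀ u, G u = F (Φ u))
    -- `μ^φ`, the law of `u ↦ u - ϕᵀ φ(u)` under `μ`, and `η = φ_♯ μ`
    (μφ : Measure X)
    (hμφ : μφ = μ.map fun u => u - ϕT (Φ u))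
    (η : Measure (EuclideanSpace ℝ (Fin N)))
    (hη : η = μ.map Φ)
    -- the system of conditional measures `μ^y_0` of `μ` given `G(u) = y`
    (κG : EuclideanSpace ℝ (Fin M) → Measure X)
    (hκGprob : ∀ y, IsProbabilityMeasure (κG y))
    (hκGmeas : ∀ A : Set X, MeasurableSet A → Measurable fun y => κG y A)
    (hκG : ∀ (A : Set X) (E : Set (EuclideanSpace ℝ (Fin M))),
      MeasurableSet A → MeasurableSet E →
        μ (A ∩ G ⁻¹' E) = ∫⁻ y in E, κG y A ∂(μ.map G))
    -- the system of conditional measures `η^y_0` of `η` given `F(z) = y`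
    (κF : EuclideanSpace ℝ (Fin M) → Measure (EuclideanSpace ℝ (Fin N)))
    (hκFprob : ∀ y, IsProbabilityMeasure (κF y))
    (hκFmeas : ∀ B : Set (EuclideanSpace ℝ (Fin N)),
      MeasurableSet B → Measurable fun y => κF y B)
    (hκF : ∀ (B : Set (EuclideanSpace ℝ (Fin N))) (E : Set (EuclideanSpace ℝ (Fin M))),
      MeasurableSet B → MeasurableSet E →
        η (B ∩ F ⁻¹' E) = ∫⁻ y in E, κF y B ∂(η.map F)) :
    ∀ᵐ y ∂(μ.map G), κG y = μφ.conv ((κF y).map ϕT) := by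
  have hFm : Measurable F := by
    refine (continuous_iff_continuousAt.2 fun z => ?_).measurable
    obtain ⟨L, hL⟩ := hF (‖z‖ + 1) (by positivity)
    exact hL.continuousOn.continuousAt (isOpen_ball.mem_nhds (by simp))
  let Φc : X →L[ℝ] EuclideanSpace ℝ (Fin N) :=
    (EuclideanSpace.equiv (Fin N) ℝ).symm.toContinuousLinearMap ∘L ContinuousLinearMap.pi φ
  have hΦc : ∀ u, Φc u = Φ u := fun u => by ext i; simp [Φc, hΦ]
  let Tc : EuclideanSpace ℝ (Fin N) →L[ℝ] X :=
    ∑ i, (EuclideanSpace.proj i : EuclideanSpace ℝ (Fin N) →L[ℝ] ℝ).smulRight (ϕ i)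
  have hTc : ∀ z, Tc z = ϕT z := fun z => by simp [Tc, hϕT]
  obtain rfl : ⇑Φc = Φ := funext hΦc
  obtain rfl : ⇑Tc = ϕT := funext hTc
  obtain rfl : G = F ∘ Φc := funext hG
  have hadj : ∀ y, K (ContinuousLinearMap.adjoint Φc y) = ∑ i, y i • θ i := by
    intro y
    have h : ContinuousLinearMap.adjoint Φc y
        = ∑ i, y i • (InnerProductSpace.toDual ℝ X).symm (φ i) := by
      refine ext_inner_right ℝ fun u => ?_
      rw [ContinuousLinearMap.adjoint_inner_left, sum_inner, PiLp.inner_apply]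
      refine Finset.sum_congr rfl fun i _ => ?_
      simp [inner_smul_left, hΦ, mul_comm]
    simp [h, hθ]
  have hsymm : Θ.IsSymm := by
    refine Matrix.IsSymm.ext fun i j => ?_
    have h : ∀ i j, Θ i j = ∫ u, φ j u * φ i u ∂μ := fun i j => by
      have h := hK ((InnerProductSpace.toDual ℝ X).symm (φ j))
        ((InnerProductSpace.toDual ℝ X).symm (φ i))
      rw [← hθ, real_inner_comm] at h
      simpa [hΘdef] using h
    rw [h, h]
    simp_rw [mul_comm]
  let R : X →L[ℝ] X := ContinuousLinearMap.id ℝ X - Tc ∘L Φc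
  have hR : ∀ k, R (θ k) = 0 := fun k => by
    simpa [R, hϕT, hϕ, hΦ] using
      sub_sum_gramInv_smul_eq_zero (fun i u => φ i u) θ Θ hΘdef hsymm hΘinv k
  have hindep : IndepFun R Φc μ :=
    hμ.indepFun_of_comp_covariance_eq_zero hK R Φc fun y => by simp [hadj, hR]
  have hμφ' : μφ = μ.map R := hμφ
  have hprod : μ.map (fun u => (R u, Φc u)) = μφ.prod η := by
    rw [hμφ', hη]
    exact (indepFun_iff_map_prod_eq_prod_map_map (by fun_prop) (by fun_prop)).1 hindep
  have : IsProbabilityMeasure η := hη ▸ Measure.isProbabilityMeasure_map (by fun_prop)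
  have : IsProbabilityMeasure μφ := hμφ' ▸ Measure.isProbabilityMeasure_map (by fun_prop)
  have hν : μ.map (F ∘ Φc) = η.map F := by
    rw [hη, Measure.map_map hFm (by fun_prop)]
  let κ : Kernel (EuclideanSpace ℝ (Fin M)) X :=
    ⟨κG, Measure.measurable_of_measurable_coe _ hκGmeas⟩
  let κ' : Kernel (EuclideanSpace ℝ (Fin M)) (EuclideanSpace ℝ (Fin N)) :=
    ⟨κF, Measure.measurable_of_measurable_coe _ hκFmeas⟩
  have : IsMarkovKernel κ := ⟨hκGprob⟩
  have : IsMarkovKernel κ' := ⟨hκFprob⟩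
  let κc : Kernel (EuclideanSpace ℝ (Fin M)) X :=
    ((Kernel.const _ μφ) ×ₖ (κ'.map Tc)).map fun p => p.1 + p.2
  have hκc : ∀ y, κc y = μφ.conv ((κF y).map Tc) := fun y => by
    rw [Kernel.map_apply _ (by fun_prop), Kernel.prod_apply, Kernel.const_apply,
      Kernel.map_apply _ (by fun_prop)]
    rfl
  have key : κ =ᵐ[μ.map (F ∘ Φc)] κc := by
    refine ae_eq_of_forall_setLIntegral_eq fun A E hA hE => ?_
    have hSE : MeasurableSet
        {p : X × EuclideanSpace ℝ (Fin N) | p.1 + Tc p.2 ∈ A ∧ F p.2 ∈ E} :=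
      ((by fun_prop : Measurable fun p : X × EuclideanSpace ℝ (Fin N) => p.1 + Tc p.2) hA).inter
        ((hFm.comp measurable_snd) hE)
    simp_rw [hκc]
    refine (hκG A E hA hE).symm.trans ?_
    rw [hν]
    refine Eq.trans ?_ (prod_preimage_eq_lintegral_conv μφ η (by fun_prop) hFm κ' hκF hA hE)
    rw [← hprod, Measure.map_apply (by fun_prop) hSE]
    congr 1
    ext u
    simp [R]
  filter_upwards [key] with y hy
  rw [← hκc, ← hy]
  rfl

end
end

section
/- Fix β > 0 and y ∈ ℝ^M. If z† ∈ ℝ^N minimizes the function z ↦ (1/(2β²)) |F(z) − y|² + ½ zᵀΘ⁻¹z over ℝ^N, then the point u† := ϕᵀ z† is a mode (MAP estimator) of the posterior μ^y_β. -/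
open MeasureTheory ProbabilityTheory Filter Topology Metric
open scoped ENNReal NNReal RealInnerProductSpace

noncomputable section

/-- `u` is a mode (MAP estimator) of the measure `ν`:
`ν(B_r(u)) / sup_{w} ν(B_r(w)) → 1` as `r → 0⁺`. -/
def IsMAP {X : Type*} [NormedAddCommGroup X] [MeasurableSpace X]
    (ν : Measure X) (u : X) : Prop :=
  Tendsto (fun r : ℝ => ν (ball u r) / ⨆ w : X, ν (ball w r)) (𝓝[>] (0 : ℝ)) (𝓝 1)

/-- Among the closed intervals of radius `s`, the centered one has the largest centered Gaussian
mass. -/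
lemma gaussianReal_closedBall_le (v : ℝ≥0) (a s : ℝ) :
    gaussianReal 0 v (closedBall a s) ≤ gaussianReal 0 v (closedBall 0 s) := by
  rcases lt_or_ge s 0 with hs | hs
  · simp [closedBall_eq_empty.2 hs]
  rcases eq_or_ne v 0 with rfl | hv
  · rw [gaussianReal_zero_var, Measure.dirac_apply' _ isClosed_closedBall.measurableSet,
      Measure.dirac_apply' _ isClosed_closedBall.measurableSet]
    by_cases h : (0 : ℝ) ∈ closedBall a s <;> simp [h, hs]
  set A := closedBall a s
  set B := closedBall (0 : ℝ) s
  have hA : MeasurableSet A := isClosed_closedBall.measurableSet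
  have hB : MeasurableSet B := isClosed_closedBall.measurableSet
  have hvol : volume (A \ B) = volume (B \ A) := by
    have h1 := measure_inter_add_sdiff (μ := volume) A hB
    have h2 := measure_inter_add_sdiff (μ := volume) B hA
    have h3 : volume A = volume B := by simp [A, B, Real.volume_closedBall]
    have h4 : volume (A ∩ B) ≠ ∞ :=
      ((measure_mono Set.inter_subset_right).trans_lt measure_closedBall_lt_top).ne
    rw [Set.inter_comm B A] at h2
    exact (ENNReal.add_right_inj h4).1 (by rw [h1, h2, h3])
  have hmono : ∀ x y : ℝ, |x| ≤ |y| → gaussianPDF 0 v y ≤ gaussianPDF 0 v x := by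
    intro x y hxy
    simp only [gaussianPDF, gaussianPDFReal, sub_zero]
    have := sq_le_sq.2 hxy
    gcongr
  rw [← measure_inter_add_sdiff (μ := gaussianReal 0 v) A hB,
    ← measure_inter_add_sdiff (μ := gaussianReal 0 v) B hA, Set.inter_comm B A]
  gcongr 1
  simp only [gaussianReal_apply 0 hv]
  calc ∫⁻ x in A \ B, gaussianPDF 0 v x
      ≤ ∫⁻ _ in A \ B, gaussianPDF 0 v s := by
        refine setLIntegral_mono measurable_const fun x hx ↦ hmono _ _ ?_
        have := hx.2
        simp only [B, mem_closedBall, Real.dist_eq, sub_zero, not_le] at this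
        rw [abs_of_nonneg hs]
        exact this.le
    _ = ∫⁻ _ in B \ A, gaussianPDF 0 v s := by simp [hvol]
    _ ≤ ∫⁻ x in B \ A, gaussianPDF 0 v x := by
        refine setLIntegral_mono (measurable_gaussianPDF 0 v) fun x hx ↦ hmono _ _ ?_
        have := hx.1
        simp only [B, mem_closedBall, Real.dist_eq, sub_zero] at this
        rwa [abs_of_nonneg hs]

lemma gaussianReal_setOf_add_sq_le (v : ℝ≥0) (a c R : ℝ) :
    gaussianReal 0 v {t | c + (t - a) ^ 2 ≤ R} ≤ gaussianReal 0 v {t | c + t ^ 2 ≤ R} := by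
  rcases lt_or_ge R c with h | h
  · have : {t : ℝ | c + (t - a) ^ 2 ≤ R} = ∅ := by
      ext t
      simp only [Set.mem_ofPred_eq, Set.mem_empty_iff_false, iff_false, not_le]
      nlinarith [sq_nonneg (t - a)]
    simp [this]
  · have key : ∀ b : ℝ, {t : ℝ | c + (t - b) ^ 2 ≤ R} = closedBall b √(R - c) := by
      intro b
      ext t
      rw [Set.mem_ofPred_eq, mem_closedBall, Real.dist_eq, ← sq_abs, Real.le_sqrt (abs_nonneg _)]
      exacts [⟨fun h ↦ by linarith, fun h ↦ by linarith⟩, sub_nonneg.2 h]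
    have h0 := key 0
    simp only [sub_zero] at h0
    rw [key, h0]
    exact gaussianReal_closedBall_le v a _

lemma pi_gaussianReal_sum_sq_le {ι : Type*} [Fintype ι] (v : ι → ℝ≥0) (w : ι → ℝ) (R : ℝ) :
    Measure.pi (fun i ↦ gaussianReal 0 (v i)) {x | ∑ i, (x i - w i) ^ 2 ≤ R} ≤
      Measure.pi (fun i ↦ gaussianReal 0 (v i)) {x | ∑ i, x i ^ 2 ≤ R} := by
  classical
  have hmeas : ∀ w : ι → ℝ, MeasurableSet {x : ι → ℝ | ∑ i, (x i - w i) ^ 2 ≤ R} := fun w ↦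
    measurableSet_le (by fun_prop) (by fun_prop)
  suffices h : ∀ S : Finset ι, Measure.pi (fun i ↦ gaussianReal 0 (v i))
      {x | ∑ i, (x i - w i) ^ 2 ≤ R} ≤ Measure.pi (fun i ↦ gaussianReal 0 (v i))
      {x | ∑ i, (x i - if i ∈ S then 0 else w i) ^ 2 ≤ R} by
    simpa using h Finset.univ
  intro S
  induction S using Finset.induction_on with
  | empty => simp
  | insert i S hi ih =>
    refine ih.trans ?_
    rw [← lintegral_indicator_one (hmeas _), ← lintegral_indicator_one (hmeas _)]
    refine lintegral_le_of_lmarginal_le {i} (measurable_one.indicator (hmeas _))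
      (measurable_one.indicator (hmeas _)) fun x ↦ ?_
    simp only [lmarginal_singleton]
    set c := ∑ j ∈ Finset.univ.erase i, (x j - if j ∈ S then 0 else w j) ^ 2
    have hind : ∀ w' : ι → ℝ, (∀ j ≠ i, w' j = if j ∈ S then 0 else w j) →
        ∫⁻ t, {x : ι → ℝ | ∑ j, (x j - w' j) ^ 2 ≤ R}.indicator 1 (Function.update x i t)
          ∂gaussianReal 0 (v i) = gaussianReal 0 (v i) {t | c + (t - w' i) ^ 2 ≤ R} := by
      intro w' hw'
      rw [← lintegral_indicator_one (measurableSet_le (by fun_prop) (by fun_prop))]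
      congr 1 with t
      have : ∑ j, (Function.update x i t j - w' j) ^ 2 = c + (t - w' i) ^ 2 := by
        rw [← Finset.sum_erase_add _ _ (Finset.mem_univ i)]
        congr 1
        · refine Finset.sum_congr rfl fun j hj ↦ ?_
          have hj := Finset.ne_of_mem_erase hj
          rw [hw' j hj, Function.update_of_ne hj]
        · simp
      simp [Set.indicator_apply, this]
    rw [hind _ fun j _ ↦ rfl, hind _ fun j hj ↦ by simp [hj]]
    simpa using gaussianReal_setOf_add_sq_le (v i) _ c R

lemma lintegral_prod_pi_fin {n : ℕ} (m : Fin n → Measure ℝ) [∀ i, SigmaFinite (m i)]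
    (f : Fin n → ℝ → ℝ≥0∞) (hf : ∀ i, Measurable (f i)) :
    ∫⁻ x, ∏ i, f i (x i) ∂Measure.pi m = ∏ i, ∫⁻ t, f i t ∂m i := by
  induction n with
  | zero => simp
  | succ n ih =>
    have h := (measurePreserving_piFinSuccAbove m 0).symm
    rw [← h.lintegral_comp_emb (MeasurableEquiv.measurableEmbedding _)]
    simp only [Fin.prod_univ_succ, MeasurableEquiv.piFinSuccAbove_symm_apply]
    simp only [Fin.insertNthEquiv, Fin.zero_succAbove, Fin.insertNth_zero', Equiv.coe_fn_mk,
      Fin.cons_zero, Fin.cons_succ]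
    rw [← ih (fun i ↦ m i.succ) (fun i ↦ f i.succ) fun i ↦ hf _]
    exact lintegral_prod_mul (f := f 0) (g := fun y : Fin n → ℝ ↦ ∏ i : Fin n, f i.succ (y i))
      (hf 0).aemeasurable
      (Finset.measurable_prod _ fun i _ ↦ (hf _).comp (measurable_pi_apply i)).aemeasurable

lemma pi_gaussianReal_eq_withDensity {n : ℕ} {v : ℝ≥0} (hv : v ≠ 0) :
    Measure.pi (fun _ : Fin n ↦ gaussianReal 0 v) =
      volume.withDensity fun x ↦ ∏ i, gaussianPDF 0 v (x i) := by
  refine Measure.pi_eq fun s hs ↦ ?_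
  rw [withDensity_apply _ (MeasurableSet.univ_pi hs), volume_pi, Measure.restrict_pi_pi,
    lintegral_prod_pi_fin _ (fun _ ↦ gaussianPDF 0 v) fun _ ↦ measurable_gaussianPDF 0 v]
  simp [gaussianReal_apply 0 hv]

namespace IsCenteredGaussian

section

variable {X : Type*} [NormedAddCommGroup X] [InnerProductSpace ℝ X] [MeasurableSpace X]
    [BorelSpace X] {μ : Measure X}

lemma isGaussian_s7 (h : IsCenteredGaussian μ) : IsGaussian μ :=
  isGaussian_of_map_eq_gaussianReal fun L ↦ ⟨0, h L⟩

lemma integral_eq_zero (h : IsCenteredGaussian μ) (f : X →L[ℝ] ℝ) : ∫ u, f u ∂μ = 0 := by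
  obtain ⟨v, hv⟩ := h f
  have h1 : ∫ x, x ∂(μ.map f) = ∫ u, f u ∂μ :=
    integral_map (φ := f) (by fun_prop) (f := fun x ↦ x) (by fun_prop)
  rw [← h1, hv, integral_id_gaussianReal]

lemma covariance_eq (h : IsCenteredGaussian μ) (f g : X →L[ℝ] ℝ) :
    cov[f, g; μ] = ∫ u, f u * g u ∂μ := by
  simp [covariance, h.integral_eq_zero]

lemma map_eq_of_integral_sq (h : IsCenteredGaussian μ) (f : X →L[ℝ] ℝ)
    (hf : ∫ u, f u * f u ∂μ = 1) : μ.map f = gaussianReal 0 1 := by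
  have := h.isGaussian_s7
  rw [IsGaussian.map_eq_gaussianReal, h.integral_eq_zero, ← covariance_self (by fun_prop),
    h.covariance_eq, hf]
  simp

lemma map {Y : Type*} [NormedAddCommGroup Y] [InnerProductSpace ℝ Y] [MeasurableSpace Y]
    [BorelSpace Y] (h : IsCenteredGaussian μ) (T : X →L[ℝ] Y) :
    IsCenteredGaussian (μ.map T) := by
  intro f
  obtain ⟨v, hv⟩ := h (f ∘L T)
  refine ⟨v, ?_⟩
  rw [Measure.map_map (by fun_prop) (by fun_prop), ← hv]
  rfl

end

variable {X : Type*} [NormedAddCommGroup X] [InnerProductSpace ℝ X] [CompleteSpace X]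
    [SecondCountableTopology X] [MeasurableSpace X] [BorelSpace X] {μ : Measure X}

/-- Every finite-dimensional subspace has an orthonormal basis along which a Gaussian measure is
uncorrelated. -/
lemma exists_orthonormalBasis (h : IsCenteredGaussian μ) (W : Submodule ℝ X)
    [FiniteDimensional ℝ W] :
    ∃ b : OrthonormalBasis (Fin (Module.finrank ℝ W)) ℝ W,
      ∀ i j, i ≠ j → ∫ u, ⟪(b i : X), u⟫ * ⟪(b j : X), u⟫ ∂μ = 0 := by
  have := h.isGaussian_s7
  have hC := covarianceOperator_inner (μ := μ) IsGaussian.memLp_two_id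
  set C := covarianceOperator μ
  set T : W →ₗ[ℝ] W := (W.orthogonalProjectionOnto ∘L C ∘L W.subtypeL).toLinearMap
  have hT1 : ∀ x y : W, ⟪T x, y⟫ = ∫ u, ⟪(x : X), u⟫ * ⟪(y : X), u⟫ ∂μ := by
    intro x y
    rw [← hC]
    simp [T]
  have hT : T.IsSymmetric := by
    intro x y
    rw [hT1, real_inner_comm, hT1]
    simp_rw [mul_comm]
  refine ⟨hT.eigenvectorBasis rfl, fun i j hij ↦ ?_⟩
  rw [← hT1, hT.apply_eigenvectorBasis, inner_smul_left,
    (hT.eigenvectorBasis rfl).inner_eq_zero hij, mul_zero]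

lemma measure_norm_starProjection_sub_le (h : IsCenteredGaussian μ) (W : Submodule ℝ X)
    [FiniteDimensional ℝ W] (w : X) {r : ℝ} (hr : 0 ≤ r) :
    μ {u | ‖W.starProjection (u - w)‖ ≤ r} ≤ μ {u | ‖W.starProjection u‖ ≤ r} := by
  have := h.isGaussian_s7
  obtain ⟨b, hb⟩ := h.exists_orthonormalBasis W
  have hnorm : ∀ x, ‖W.starProjection x‖ ≤ r ↔ ∑ i, ⟪(b i : X), x⟫ ^ 2 ≤ r ^ 2 := by
    intro x
    have h1 : ‖W.starProjection x‖ ^ 2 = ∑ i, ⟪(b i : X), x⟫ ^ 2 := by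
      rw [Submodule.starProjection_apply, ← Submodule.coe_norm, ← b.sum_sq_norm_inner_right]
      simp
    rw [← h1, sq_le_sq₀ (norm_nonneg _) hr]
  set L : X →L[ℝ] (Fin (Module.finrank ℝ W) → ℝ) :=
    ContinuousLinearMap.pi fun i ↦ innerSL ℝ (b i : X)
  have hL : ∀ u i, L u i = ⟪(b i : X), u⟫ := fun u i ↦ rfl
  have hind : iIndepFun (fun i u ↦ L u i) μ := by
    refine HasGaussianLaw.iIndepFun_of_covariance_eq_zero ⟨isGaussian_map L⟩ fun i j hij ↦ ?_
    exact (h.covariance_eq (innerSL ℝ (b i : X)) (innerSL ℝ (b j : X))).trans (hb i j hij)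
  have hlaw := (iIndepFun_iff_map_fun_eq_pi_map fun i ↦ by fun_prop).1 hind
  choose v hv using fun i ↦ h (innerSL ℝ (b i : X))
  have hlaw : μ.map L = Measure.pi fun i ↦ gaussianReal 0 (v i) := by
    rw [← funext hv]
    exact hlaw
  have hset : ∀ w, μ {u | ‖W.starProjection (u - w)‖ ≤ r} =
      μ.map L {x | ∑ i, (x i - L w i) ^ 2 ≤ r ^ 2} := by
    intro w
    rw [Measure.map_apply (by fun_prop) (measurableSet_le (by fun_prop) (by fun_prop))]
    congr 1 with u
    rw [Set.mem_ofPred_eq, hnorm]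
    simp [hL, inner_sub_right]
  have h0 := hset 0
  simp only [sub_zero, map_zero, Pi.zero_apply] at h0
  rw [h0, hset, hlaw]
  exact pi_gaussianReal_sum_sq_le v (L w) (r ^ 2)

lemma measure_ball_le_closedBall [IsProbabilityMeasure μ] (h : IsCenteredGaussian μ) (w : X)
    {r : ℝ} (hr : 0 ≤ r) : μ (ball w r) ≤ μ (closedBall 0 r) := by
  let d := TopologicalSpace.denseSeq X
  let W : ℕ → Submodule ℝ X := fun n ↦ Submodule.span ℝ (d '' Set.Iic n)
  have hfin : ∀ n, FiniteDimensional ℝ (W n) := fun n ↦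
    FiniteDimensional.span_of_finite ℝ ((Set.finite_Iic n).image d)
  have hmono : Monotone W := fun m n hmn ↦
    Submodule.span_mono (Set.image_mono (Set.Iic_subset_Iic.2 hmn))
  have hdense : ⊤ ≤ (⨆ n, W n).topologicalClosure := by
    intro x _
    rw [← SetLike.mem_coe, Submodule.topologicalClosure_coe]
    refine closure_mono ?_ (TopologicalSpace.denseRange_denseSeq X x)
    rintro _ ⟨n, rfl⟩
    exact Submodule.mem_iSup_of_mem n (Submodule.subset_span ⟨n, Set.mem_Iic.2 le_rfl, rfl⟩)
  let S : ℕ → Set X := fun n ↦ {u | ‖(W n).starProjection u‖ ≤ r}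
  have hS : ∀ n, MeasurableSet (S n) := fun n ↦ measurableSet_le (by fun_prop) (by fun_prop)
  have hanti : Antitone S := by
    intro m n hmn u hu
    refine le_trans ?_ (Set.mem_ofPred_eq ▸ hu)
    have : (W m).starProjection u = (W m).starProjection ((W n).starProjection u) := by
      have := Submodule.starProjection_comp_starProjection_of_le (hmono hmn)
      exact (DFunLike.congr_fun this u).symm
    rw [this]
    exact (W m).norm_starProjection_apply_le _
  have hinter : ⋂ n, S n = closedBall 0 r := by
    ext u
    simp only [Set.mem_iInter, mem_closedBall, dist_zero_right, S, Set.mem_ofPred_eq]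
    constructor
    · intro hu
      exact le_of_tendsto (Submodule.starProjection_tendsto_self W hmono u hdense).norm
        (Eventually.of_forall hu)
    · exact fun hu n ↦ ((W n).norm_starProjection_apply_le u).trans hu
  rw [← hinter]
  refine ge_of_tendsto' (tendsto_measure_iInter_atTop (fun n ↦ (hS n).nullMeasurableSet) hanti
    ⟨0, measure_ne_top _ _⟩) fun n ↦ ?_
  refine (measure_mono fun u hu ↦ ?_).trans (h.measure_norm_starProjection_sub_le (W n) w hr)
  rw [mem_ball, dist_eq_norm] at hu
  exact ((W n).norm_starProjection_apply_le _).trans hu.le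

/-- Among the balls of radius `r`, the centered one has the largest centered Gaussian mass. -/
lemma measure_ball_le [IsProbabilityMeasure μ] (h : IsCenteredGaussian μ) (w : X) (r : ℝ) :
    μ (ball w r) ≤ μ (ball 0 r) := by
  obtain ⟨s, hs, hsr, hlim⟩ := exists_seq_strictMono_tendsto r
  have hU : ball w r = ⋃ n, ball w (s n) := by
    ext u
    simp only [mem_ball, Set.mem_iUnion]
    exact ⟨fun hu ↦ (hlim.eventually (lt_mem_nhds hu)).exists,
      fun ⟨n, hn⟩ ↦ hn.trans (hsr n)⟩
  rw [hU, (monotone_nat_of_le_succ fun n ↦ ball_subset_ball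
    (hs n.lt_succ_self).le).measure_iUnion]
  refine iSup_le fun n ↦ ?_
  rcases lt_or_ge (s n) 0 with hn | hn
  · simp [ball_eq_empty.2 hn.le]
  · exact (h.measure_ball_le_closedBall w hn).trans
      (measure_mono (closedBall_subset_ball (hsr n)))

end IsCenteredGaussian

lemma prod_gaussianPDF {N : ℕ} (v : ℝ≥0) (x : Fin N → ℝ) :
    ∏ i, gaussianPDF 0 v (x i) = ENNReal.ofReal ((√(2 * Real.pi * v))⁻¹) ^ N *
      ENNReal.ofReal (Real.exp (-(∑ i, x i ^ 2) / (2 * v))) := by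
  simp only [gaussianPDF, gaussianPDFReal, sub_zero]
  rw [← ENNReal.ofReal_prod_of_nonneg fun i _ ↦ by positivity, Finset.prod_mul_distrib,
    ← Real.exp_sum, ENNReal.ofReal_mul (by positivity)]
  rw [Finset.prod_const, Finset.card_univ, Fintype.card_fin, ENNReal.ofReal_pow (by positivity),
    ← Finset.sum_div, Finset.sum_neg_distrib]

section Decomposition

variable {X : Type*} [NormedAddCommGroup X] [InnerProductSpace ℝ X] {N : ℕ}

/-- The linear combination map `x ↦ ∑ i, x i • e i`. -/
def synthesis (e : Fin N → X) : (Fin N → ℝ) →L[ℝ] X :=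
  ∑ i, (ContinuousLinearMap.proj i : (Fin N → ℝ) →L[ℝ] ℝ).smulRight (e i)

@[simp]
lemma synthesis_apply (e : Fin N → X) (x : Fin N → ℝ) : synthesis e x = ∑ i, x i • e i := by
  simp [synthesis]

/-- The part of `u` that remains after removing its components `ψ i u` along the `e i`. -/
def synthesisResidual (ψ : Fin N → X →L[ℝ] ℝ) (e : Fin N → X) : X →L[ℝ] X :=
  ContinuousLinearMap.id ℝ X - synthesis e ∘L ContinuousLinearMap.pi ψ

lemma synthesis_add_residual (ψ : Fin N → X →L[ℝ] ℝ) (e : Fin N → X) (u : X) :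
    synthesis e (ContinuousLinearMap.pi ψ u) + synthesisResidual ψ e u = u := by
  simp [synthesisResidual]

lemma synthesisResidual_eq_zero {ψ : Fin N → X →L[ℝ] ℝ} {e : Fin N → X}
    (hψe : ∀ i j, ψ i (e j) = if i = j then 1 else 0) (i : Fin N) :
    synthesisResidual ψ e (e i) = 0 := by
  simp [synthesisResidual, hψe]

variable [MeasurableSpace X]

/-- The mass that the fiber over `x` gives to the ball `B_r(w)`. -/
def fiberMass (ρ : Measure X) (e : Fin N → X) (w : X) (r : ℝ) (x : Fin N → ℝ) : ℝ≥0∞ :=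
  ρ {v | synthesis e x + v ∈ ball w r}

lemma lintegral_fiberMass_synthesis (ρ : Measure X) (e : Fin N → X) (a : Fin N → ℝ) (r : ℝ) :
    ∫⁻ x, fiberMass ρ e (synthesis e a) r x = ∫⁻ x, fiberMass ρ e 0 r x := by
  rw [← lintegral_sub_right_eq_self (fiberMass ρ e 0 r) a]
  refine lintegral_congr fun x ↦ congrArg ρ ?_
  ext v
  simp only [Set.mem_ofPred_eq, mem_ball, dist_eq_norm, map_sub, sub_zero]
  rw [sub_add_eq_add_sub]

variable [SecondCountableTopology X] [BorelSpace X]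

lemma measurableSet_synthesis_add_mem_ball (e : Fin N → X) (w : X) (r : ℝ) :
    MeasurableSet {p : (Fin N → ℝ) × X | synthesis e p.1 + p.2 ∈ ball w r} :=
  (by fun_prop : Measurable fun p : (Fin N → ℝ) × X ↦ synthesis e p.1 + p.2) measurableSet_ball

lemma measurable_fiberMass (ρ : Measure X) [SFinite ρ] (e : Fin N → X) (w : X) (r : ℝ) :
    Measurable (fiberMass ρ e w r) :=
  measurable_measure_prodMk_left (measurableSet_synthesis_add_mem_ball e w r)

lemma lintegral_indicator_fiber (ρ : Measure X) (e : Fin N → X) (w : X) (r : ℝ) (x : Fin N → ℝ) :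
    ∫⁻ v, {p : (Fin N → ℝ) × X | synthesis e p.1 + p.2 ∈ ball w r}.indicator 1 (x, v) ∂ρ =
      fiberMass ρ e w r x := by
  have hm : MeasurableSet {v | synthesis e x + v ∈ ball w r} :=
    (measurableSet_synthesis_add_mem_ball e w r).preimage measurable_prodMk_left
  rw [fiberMass, ← lintegral_indicator_one hm]
  rfl

variable [CompleteSpace X] {μ : Measure X} [IsProbabilityMeasure μ]

/-- A centered Gaussian measure is the product of a standard Gaussian along finitely many
orthonormal functionals and the law of the residual. -/
lemma IsCenteredGaussian.map_prodMk_residual (h : IsCenteredGaussian μ)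
    {ψ : Fin N → X →L[ℝ] ℝ} {e : Fin N → X}
    (hψe : ∀ i j, ψ i (e j) = if i = j then 1 else 0)
    (he : ∀ i (f : X →L[ℝ] ℝ), ∫ u, ψ i u * f u ∂μ = f (e i)) :
    μ.map (fun u ↦ (ContinuousLinearMap.pi ψ u, synthesisResidual ψ e u)) =
      (Measure.pi fun _ : Fin N ↦ gaussianReal 0 1).prod (μ.map (synthesisResidual ψ e)) := by
  have := h.isGaussian_s7
  have hind : IndepFun (ContinuousLinearMap.pi ψ) (synthesisResidual ψ e) μ := by
    refine HasGaussianLaw.indepFun_of_covariance_strongDual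
      ⟨isGaussian_map ((ContinuousLinearMap.pi ψ).prod (synthesisResidual ψ e))⟩ fun L₁ L₂ ↦ ?_
    refine (h.covariance_eq (L₁ ∘L ContinuousLinearMap.pi ψ) (L₂ ∘L synthesisResidual ψ e)).trans ?_
    have hL₁ : ∀ x, L₁ x = ∑ i, x i * L₁ (Pi.single i 1) := by
      intro x
      conv_lhs => rw [← Finset.univ_sum_single x, map_sum]
      refine Finset.sum_congr rfl fun i _ ↦ ?_
      rw [← smul_eq_mul, ← map_smul, ← Pi.single_smul, smul_eq_mul, mul_one]
    have hexp : ∀ u, (L₁ ∘L ContinuousLinearMap.pi ψ) u * (L₂ ∘L synthesisResidual ψ e) u =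
        ∑ i, L₁ (Pi.single i 1) * (ψ i u * (L₂ ∘L synthesisResidual ψ e) u) := by
      intro u
      rw [ContinuousLinearMap.comp_apply, hL₁, Finset.sum_mul]
      refine Finset.sum_congr rfl fun i _ ↦ ?_
      simp only [ContinuousLinearMap.pi_apply]
      ring
    simp_rw [hexp]
    rw [integral_finsetSum]
    · refine Finset.sum_eq_zero fun i _ ↦ ?_
      rw [integral_const_mul, he, ContinuousLinearMap.comp_apply, synthesisResidual_eq_zero hψe,
        map_zero, mul_zero]
    · exact fun i _ ↦ ((IsGaussian.memLp_dual μ (ψ i) 2 (by simp)).integrable_mul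
        (IsGaussian.memLp_dual μ (L₂ ∘L synthesisResidual ψ e) 2 (by simp))).const_mul _
  have hiind : iIndepFun (fun i u ↦ ψ i u) μ := by
    refine HasGaussianLaw.iIndepFun_of_covariance_eq_zero
      ⟨isGaussian_map (ContinuousLinearMap.pi ψ)⟩ fun i j hij ↦ ?_
    rw [h.covariance_eq, he, hψe, if_neg hij.symm]
  have hpi : μ.map (ContinuousLinearMap.pi ψ) = Measure.pi fun _ ↦ gaussianReal 0 1 := by
    refine ((iIndepFun_iff_map_fun_eq_pi_map fun i ↦ by fun_prop).1 hiind).trans ?_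
    congr 1 with i : 1
    exact h.map_eq_of_integral_sq (ψ i) (by rw [he, hψe, if_pos rfl])
  rw [← hpi]
  exact (indepFun_iff_map_prod_eq_prod_map_map (by fun_prop) (by fun_prop)).1 hind

lemma IsCenteredGaussian.lintegral_residual (h : IsCenteredGaussian μ)
    {ψ : Fin N → X →L[ℝ] ℝ} {e : Fin N → X}
    (hψe : ∀ i j, ψ i (e j) = if i = j then 1 else 0)
    (he : ∀ i (f : X →L[ℝ] ℝ), ∫ u, ψ i u * f u ∂μ = f (e i))
    {H : (Fin N → ℝ) × X → ℝ≥0∞} (hH : Measurable H) :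
    ∫⁻ u, H (ContinuousLinearMap.pi ψ u, synthesisResidual ψ e u) ∂μ =
      ∫⁻ x, ∫⁻ v, H (x, v) ∂μ.map (synthesisResidual ψ e)
        ∂Measure.pi fun _ : Fin N ↦ gaussianReal 0 1 := by
  rw [← lintegral_prod _ hH.aemeasurable, ← h.map_prodMk_residual hψe he,
    lintegral_map hH (by fun_prop)]

variable {ψ : Fin N → X →L[ℝ] ℝ} {e : Fin N → X}

/-- Stretching the component of `u` along the `e i` by the factor `n` turns the standard Gaussian
in that component into a Gaussian of variance `n ^ 2`. -/
lemma IsCenteredGaussian.map_stretch_ball (h : IsCenteredGaussian μ)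
    (hψe : ∀ i j, ψ i (e j) = if i = j then 1 else 0)
    (he : ∀ i (f : X →L[ℝ] ℝ), ∫ u, ψ i u * f u ∂μ = f (e i)) (n : ℝ≥0) (w : X) (r : ℝ) :
    μ.map ((n : ℝ) • (synthesis e ∘L ContinuousLinearMap.pi ψ) + synthesisResidual ψ e) (ball w r) =
      ∫⁻ x, fiberMass (μ.map (synthesisResidual ψ e)) e w r x
        ∂Measure.pi fun _ : Fin N ↦ gaussianReal 0 (n ^ 2) := by
  have hscale : (Measure.pi fun _ : Fin N ↦ gaussianReal 0 1).map (fun x i ↦ (n : ℝ) * x i) =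
      Measure.pi fun _ : Fin N ↦ gaussianReal 0 (n ^ 2) := by
    have hmap : ∀ _ : Fin N, (gaussianReal 0 1).map (fun x ↦ (n : ℝ) * x) =
        gaussianReal 0 (n ^ 2) := by
      intro _
      rw [gaussianReal_map_const_mul]
      congr 1
      · simp
      · ext; simp
    have : ∀ i : Fin N, SigmaFinite ((gaussianReal 0 1).map (fun x ↦ (n : ℝ) * x)) := by
      intro i
      rw [hmap i]
      infer_instance
    rw [Measure.pi_map_pi (μ := fun _ : Fin N ↦ gaussianReal 0 1) fun _ ↦ by fun_prop]
    exact congrArg Measure.pi (funext hmap)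
  set A := {p : (Fin N → ℝ) × X | synthesis e p.1 + p.2 ∈ ball w r}
  have hA : MeasurableSet A := measurableSet_synthesis_add_mem_ball e w r
  have hH : Measurable fun p : (Fin N → ℝ) × X ↦
      A.indicator (1 : (Fin N → ℝ) × X → ℝ≥0∞) (fun i ↦ (n : ℝ) * p.1 i, p.2) :=
    (measurable_one.indicator hA).comp (by fun_prop)
  rw [← hscale, lintegral_map (measurable_fiberMass _ e w r) (by fun_prop),
    ← lintegral_indicator_one measurableSet_ball,
    lintegral_map (measurable_one.indicator measurableSet_ball) (by fun_prop)]
  simp_rw [← lintegral_indicator_fiber]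
  rw [← h.lintegral_residual hψe he hH]
  refine lintegral_congr fun u ↦ ?_
  have : synthesis e (fun i ↦ (n : ℝ) * ContinuousLinearMap.pi ψ u i) + synthesisResidual ψ e u =
      ((n : ℝ) • (synthesis e ∘L ContinuousLinearMap.pi ψ) + synthesisResidual ψ e) u := by
    simp [Finset.smul_sum, smul_smul]
  rw [← this]
  rfl

/-- Removing the Gaussian density along the `e i` leaves Lebesgue measure, up to a constant. -/
lemma IsCenteredGaussian.setLIntegral_exp_ball (h : IsCenteredGaussian μ)
    (hψe : ∀ i j, ψ i (e j) = if i = j then 1 else 0)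
    (he : ∀ i (f : X →L[ℝ] ℝ), ∫ u, ψ i u * f u ∂μ = f (e i)) (w : X) (r : ℝ) :
    ∫⁻ u in ball w r, ENNReal.ofReal (Real.exp ((∑ i, ψ i u ^ 2) / 2)) ∂μ =
      ENNReal.ofReal ((√(2 * Real.pi))⁻¹) ^ N *
        ∫⁻ x, fiberMass (μ.map (synthesisResidual ψ e)) e w r x := by
  set A := {p : (Fin N → ℝ) × X | synthesis e p.1 + p.2 ∈ ball w r}
  have hA : MeasurableSet A := measurableSet_synthesis_add_mem_ball e w r
  have hE : Measurable fun x : Fin N → ℝ ↦ ENNReal.ofReal (Real.exp ((∑ i, x i ^ 2) / 2)) := by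
    fun_prop
  have hH : Measurable fun p : (Fin N → ℝ) × X ↦
      ENNReal.ofReal (Real.exp ((∑ i, p.1 i ^ 2) / 2)) * A.indicator (1 : (Fin N → ℝ) × X → ℝ≥0∞) p :=
    (hE.comp measurable_fst).mul (measurable_one.indicator hA)
  have hρ := measurable_fiberMass (μ.map (synthesisResidual ψ e)) e w r
  have hp : Measurable fun x : Fin N → ℝ ↦ ∏ i, gaussianPDF 0 1 (x i) :=
    Finset.measurable_prod _ fun i _ ↦ (measurable_gaussianPDF 0 1).comp (measurable_pi_apply i)
  have hin : ∀ x : Fin N → ℝ, ∫⁻ v, ENNReal.ofReal (Real.exp ((∑ i, x i ^ 2) / 2)) *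
      A.indicator (1 : (Fin N → ℝ) × X → ℝ≥0∞) (x, v) ∂μ.map (synthesisResidual ψ e) =
      ENNReal.ofReal (Real.exp ((∑ i, x i ^ 2) / 2)) *
        fiberMass (μ.map (synthesisResidual ψ e)) e w r x := fun x ↦ by
    rw [← lintegral_indicator_fiber]
    exact lintegral_const_mul _ ((measurable_one.indicator hA).comp measurable_prodMk_left)
  calc ∫⁻ u in ball w r, ENNReal.ofReal (Real.exp ((∑ i, ψ i u ^ 2) / 2)) ∂μ
      = ∫⁻ u, ENNReal.ofReal (Real.exp ((∑ i, ContinuousLinearMap.pi ψ u i ^ 2) / 2)) *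
          A.indicator (1 : (Fin N → ℝ) × X → ℝ≥0∞)
            (ContinuousLinearMap.pi ψ u, synthesisResidual ψ e u) ∂μ := by
        rw [← lintegral_indicator measurableSet_ball]
        refine lintegral_congr fun u ↦ ?_
        have hu : (ContinuousLinearMap.pi ψ u, synthesisResidual ψ e u) ∈ A ↔ u ∈ ball w r := by
          rw [Set.mem_ofPred_eq, synthesis_add_residual]
        by_cases hb : u ∈ ball w r
        · rw [Set.indicator_of_mem hb, Set.indicator_of_mem (hu.2 hb), Pi.one_apply, mul_one]
          rfl
        · rw [Set.indicator_of_notMem hb, Set.indicator_of_notMem (mt hu.1 hb), mul_zero]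
    _ = ∫⁻ x, ENNReal.ofReal ((√(2 * Real.pi))⁻¹) ^ N *
          fiberMass (μ.map (synthesisResidual ψ e)) e w r x := by
        rw [h.lintegral_residual hψe he hH, pi_gaussianReal_eq_withDensity one_ne_zero]
        simp_rw [hin]
        refine (lintegral_withDensity_eq_lintegral_mul _ hp (hE.mul hρ)).trans ?_
        refine lintegral_congr fun x ↦ ?_
        rw [Pi.mul_apply, Pi.mul_apply, prod_gaussianPDF, ← mul_assoc, mul_assoc (_ ^ N),
          ← ENNReal.ofReal_mul (by positivity), ← Real.exp_add]
        simp [neg_div]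
    _ = _ := lintegral_const_mul _ hρ

lemma IsCenteredGaussian.lintegral_fiberMass_le (h : IsCenteredGaussian μ)
    (hψe : ∀ i j, ψ i (e j) = if i = j then 1 else 0)
    (he : ∀ i (f : X →L[ℝ] ℝ), ∫ u, ψ i u * f u ∂μ = f (e i)) (w : X) (r : ℝ) :
    ∫⁻ x, fiberMass (μ.map (synthesisResidual ψ e)) e w r x ≤
      ∫⁻ x, fiberMass (μ.map (synthesisResidual ψ e)) e 0 r x := by
  set ρ := μ.map (synthesisResidual ψ e)
  let d : ℕ → (Fin N → ℝ) → ℝ≥0∞ := fun n x ↦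
    ENNReal.ofReal (Real.exp (-(∑ i, x i ^ 2) / (2 * ((n : ℝ) + 1) ^ 2)))
  have hd : ∀ n, Measurable (d n) := fun n ↦ by fun_prop
  have hd1 : ∀ n x, d n x ≤ 1 := by
    intro n x
    refine ENNReal.ofReal_le_one.2 (Real.exp_le_one_iff.2 ?_)
    exact div_nonpos_of_nonpos_of_nonneg
      (neg_nonpos.2 (Finset.sum_nonneg fun i _ ↦ sq_nonneg _)) (by positivity)
  have hlim : ∀ x, Tendsto (fun n ↦ d n x) atTop (𝓝 1) := by
    intro x
    have h1 : Tendsto (fun n : ℕ ↦ 2 * ((n : ℝ) + 1) ^ 2) atTop atTop :=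
      ((tendsto_pow_atTop two_ne_zero).comp
        (tendsto_atTop_add_const_right _ 1 tendsto_natCast_atTop_atTop)).const_mul_atTop two_pos
    have h2 := (Real.continuous_exp.tendsto 0).comp
      ((tendsto_const_nhds (x := -(∑ i, x i ^ 2))).div_atTop h1)
    rw [Real.exp_zero] at h2
    simpa [d, Function.comp_def] using ENNReal.tendsto_ofReal h2
  have hstep : ∀ n, ∫⁻ x, d n x * fiberMass ρ e w r x ≤ ∫⁻ x, fiberMass ρ e 0 r x := by
    intro n
    set t : ℝ≥0 := (n : ℝ≥0) + 1
    have ht : t ^ 2 ≠ 0 := by positivity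
    set T := ((t : ℝ) • (synthesis e ∘L ContinuousLinearMap.pi ψ) + synthesisResidual ψ e)
    have hprob : IsProbabilityMeasure (μ.map T) :=
      Measure.isProbabilityMeasure_map (by fun_prop)
    set c := ENNReal.ofReal ((√(2 * Real.pi * (t ^ 2 : ℝ≥0)))⁻¹) ^ N
    have hc0 : c ≠ 0 := pow_ne_zero _ (by rw [Ne, ENNReal.ofReal_eq_zero, not_le]; positivity)
    have hc : c ≠ ∞ := ENNReal.pow_ne_top ENNReal.ofReal_ne_top
    have hint : ∀ w, μ.map T (ball w r) = c * ∫⁻ x, d n x * fiberMass ρ e w r x := by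
      intro w
      have hρ := measurable_fiberMass ρ e w r
      have hp : Measurable fun x : Fin N → ℝ ↦ ∏ i, gaussianPDF 0 (t ^ 2) (x i) :=
        Finset.measurable_prod _ fun i _ ↦
          (measurable_gaussianPDF 0 _).comp (measurable_pi_apply i)
      rw [h.map_stretch_ball hψe he t w r, pi_gaussianReal_eq_withDensity ht,
        lintegral_withDensity_eq_lintegral_mul _ hp hρ]
      refine Eq.trans (lintegral_congr fun x ↦ ?_) (lintegral_const_mul c ((hd n).mul hρ))
      rw [Pi.mul_apply, prod_gaussianPDF, mul_assoc]
      simp [c, d, t]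
    have hle := (h.map T).measure_ball_le w r
    rw [hint, hint, ENNReal.mul_le_mul_iff_right hc0 hc] at hle
    exact hle.trans (lintegral_mono fun x ↦ mul_le_of_le_one_left' (hd1 n x))
  have hfatou := lintegral_liminf_le (μ := volume) (u := atTop)
    (f := fun n x ↦ d n x * fiberMass ρ e w r x)
    fun n ↦ (hd n).mul (measurable_fiberMass ρ e w r)
  have hliminf : ∀ x, liminf (fun n ↦ d n x * fiberMass ρ e w r x) atTop =
      fiberMass ρ e w r x := by
    intro x
    have := ENNReal.Tendsto.mul_const (hlim x) (b := fiberMass ρ e w r x) (Or.inl one_ne_zero)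
    rw [one_mul] at this
    exact this.liminf_eq
  simp_rw [hliminf] at hfatou
  refine hfatou.trans (liminf_le_of_le (by isBoundedDefault) fun b hb ↦ ?_)
  obtain ⟨n, hn⟩ := hb.exists
  exact hn.trans (hstep n)

lemma IsCenteredGaussian.setLIntegral_exp_ball_le (h : IsCenteredGaussian μ)
    (hψe : ∀ i j, ψ i (e j) = if i = j then 1 else 0)
    (he : ∀ i (f : X →L[ℝ] ℝ), ∫ u, ψ i u * f u ∂μ = f (e i)) (w : X) (a : Fin N → ℝ) (r : ℝ) :
    ∫⁻ u in ball w r, ENNReal.ofReal (Real.exp ((∑ i, ψ i u ^ 2) / 2)) ∂μ ≤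
      ∫⁻ u in ball (synthesis e a) r,
        ENNReal.ofReal (Real.exp ((∑ i, ψ i u ^ 2) / 2)) ∂μ := by
  rw [h.setLIntegral_exp_ball hψe he, h.setLIntegral_exp_ball hψe he,
    lintegral_fiberMass_synthesis]
  exact mul_le_mul_right (h.lintegral_fiberMass_le hψe he w r) _

end Decomposition

section Mode

variable {X : Type*} [NormedAddCommGroup X] [SecondCountableTopology X] [MeasurableSpace X]

lemma isMAP_of_forall_ball_le {ν : Measure X} [IsFiniteMeasure ν] (hν : ν ≠ 0) {u : X}
    (h : ∀ ε > 0, ∀ᶠ r in 𝓝[>] (0 : ℝ), ∀ w,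
      ENNReal.ofReal (Real.exp (-ε)) * ν (ball w r) ≤ ν (ball u r)) :
    IsMAP ν u := by
  refine tendsto_order.2 ⟨fun a ha ↦ ?_, fun a ha ↦ .of_forall fun r ↦ ?_⟩
  · have hlim : Tendsto (fun ε : ℝ ↦ ENNReal.ofReal (Real.exp (-ε))) (𝓝[>] 0) (𝓝 1) := by
      have : Continuous fun ε : ℝ ↦ ENNReal.ofReal (Real.exp (-ε)) :=
        ENNReal.continuous_ofReal.comp (by fun_prop)
      simpa using (this.tendsto 0).mono_left nhdsWithin_le_nhds
    obtain ⟨ε, haε, hε⟩ := ((hlim.eventually_const_lt ha).and self_mem_nhdsWithin).exists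
    filter_upwards [h ε hε, self_mem_nhdsWithin] with r hr hr0
    have hzero : (⨆ w, ν (ball w r)) ≠ 0 := by
      intro hS
      refine hν (Measure.measure_univ_eq_zero.1 (measure_null_of_locally_null _ fun x _ ↦ ?_))
      exact ⟨ball x r, mem_nhdsWithin_of_mem_nhds (ball_mem_nhds x hr0),
        ENNReal.iSup_eq_zero.1 hS x⟩
    refine haε.trans_le ((ENNReal.le_div_iff_mul_le (.inl hzero) (.inr (measure_ne_top ν _))).2 ?_)
    rw [ENNReal.mul_iSup]
    exact iSup_le hr
  · refine lt_of_le_of_lt (ENNReal.div_le_of_le_mul ?_) ha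
    rw [one_mul]
    exact le_iSup (fun w ↦ ν (ball w r)) u

end Mode

/-- The mode of a Gaussian measure reweighted by `exp (-G)`, where `G` depends only on finitely many
orthonormal functionals: minimizing `G x + |x| ^ 2 / 2` over the coordinates suffices. -/
theorem IsCenteredGaussian.isMAP_withDensity {X : Type*} [NormedAddCommGroup X]
    [InnerProductSpace ℝ X] [CompleteSpace X] [SecondCountableTopology X] [MeasurableSpace X]
    [BorelSpace X] {N : ℕ} {μ : Measure X} [IsProbabilityMeasure μ] (h : IsCenteredGaussian μ)
    {ψ : Fin N → X →L[ℝ] ℝ} {e : Fin N → X}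
    (hψe : ∀ i j, ψ i (e j) = if i = j then 1 else 0)
    (he : ∀ i (f : X →L[ℝ] ℝ), ∫ u, ψ i u * f u ∂μ = f (e i))
    {G : (Fin N → ℝ) → ℝ} (hG : Continuous G) (hG0 : ∀ x, 0 ≤ G x) {c : ℝ} (hc : 0 < c)
    {a : Fin N → ℝ} (ha : ∀ x, G a + (∑ i, a i ^ 2) / 2 ≤ G x + (∑ i, x i ^ 2) / 2) :
    IsMAP (μ.withDensity fun u ↦
      ENNReal.ofReal (c * Real.exp (-G (ContinuousLinearMap.pi ψ u)))) (synthesis e a) := by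
  set p := ContinuousLinearMap.pi ψ
  set ν := μ.withDensity fun u ↦ ENNReal.ofReal (c * Real.exp (-G (p u)))
  let J : (Fin N → ℝ) → ℝ := fun x ↦ G x + (∑ i, x i ^ 2) / 2
  have hJ : Continuous J := by fun_prop
  let E : X → ℝ≥0∞ := fun u ↦ ENNReal.ofReal (Real.exp ((∑ i, ψ i u ^ 2) / 2))
  have hE : Measurable E := by fun_prop
  have hsplit : ∀ u, ENNReal.ofReal (c * Real.exp (-G (p u))) =
      ENNReal.ofReal (c * Real.exp (-J (p u))) * E u := by
    intro u
    rw [← ENNReal.ofReal_mul (by positivity), mul_assoc, ← Real.exp_add]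
    congr 3
    simp [J, p]
  have : IsFiniteMeasure ν := by
    refine isFiniteMeasure_withDensity (ne_top_of_le_ne_top (b := ENNReal.ofReal c) (by simp) ?_)
    refine (lintegral_mono (g := fun _ ↦ ENNReal.ofReal c) fun u ↦
      ENNReal.ofReal_le_ofReal ?_).trans_eq (by simp)
    exact mul_le_of_le_one_right hc.le (Real.exp_le_one_iff.2 (neg_nonpos.2 (hG0 _)))
  have hν : ν ≠ 0 := by
    intro h0
    have hG' : Measurable fun u ↦ ENNReal.ofReal (c * Real.exp (-G (p u))) := by fun_prop
    obtain ⟨u, hu⟩ := ((withDensity_eq_zero_iff hG'.aemeasurable).1 h0).exists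
    rw [Pi.zero_apply, ENNReal.ofReal_eq_zero, ← not_lt] at hu
    exact hu (by positivity)
  refine isMAP_of_forall_ball_le hν fun ε hε ↦ ?_
  have hpa : p (synthesis e a) = a := by
    ext i
    simp [p, hψe]
  have hnear : ∀ᶠ u in 𝓝 (synthesis e a), J (p u) < J a + ε := by
    refine (hJ.comp p.continuous).continuousAt.eventually_lt_const ?_
    simpa [hpa, -synthesis_apply] using hε
  obtain ⟨δ, hδ, hball⟩ := Metric.eventually_nhds_iff_ball.1 hnear
  filter_upwards [Ioo_mem_nhdsGT hδ] with r hr w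
  set k := ENNReal.ofReal (c * Real.exp (-J a))
  have hup : ν (ball w r) ≤ k * ∫⁻ u in ball w r, E u ∂μ := by
    rw [withDensity_apply _ measurableSet_ball, ← lintegral_const_mul _ hE]
    refine lintegral_mono fun u ↦ ?_
    rw [hsplit]
    refine mul_le_mul_left (ENNReal.ofReal_le_ofReal ?_) _
    gcongr
    exact ha (p u)
  have hlow : ENNReal.ofReal (Real.exp (-ε)) * (k * ∫⁻ u in ball (synthesis e a) r, E u ∂μ) ≤
      ν (ball (synthesis e a) r) := by
    rw [withDensity_apply _ measurableSet_ball, ← mul_assoc, ← lintegral_const_mul _ hE]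
    refine setLIntegral_mono' measurableSet_ball fun u hu ↦ ?_
    rw [hsplit]
    refine mul_le_mul_left ?_ _
    rw [← ENNReal.ofReal_mul (by positivity), mul_left_comm, ← Real.exp_add]
    have := hball u (ball_subset_ball hr.2.le hu)
    gcongr
    linarith
  refine le_trans ?_ hlow
  gcongr
  refine hup.trans ?_
  exact mul_le_mul_right (h.setLIntegral_exp_ball_le hψe he w a r) _

open scoped Matrix MatrixOrder in
lemma Matrix.PosSemidef.exists_transpose_mul_self_eq_inv {N : ℕ} {Θ : Matrix (Fin N) (Fin N) ℝ}
    (hΘ : Θ.PosSemidef) (hdet : IsUnit Θ.det) :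
    ∃ A : Matrix (Fin N) (Fin N) ℝ, IsUnit A.det ∧ Aᵀ * A = Θ⁻¹ ∧ A * Θ * Aᵀ = 1 := by
  obtain ⟨A, hA⟩ := CStarAlgebra.nonneg_iff_eq_star_mul_self.1 hΘ.inv.nonneg
  have hA : Aᵀ * A = Θ⁻¹ := by
    rw [hA, Matrix.star_eq_conjTranspose, conjTranspose_eq_transpose_of_trivial]
  have h1 : A * Θ * Aᵀ = 1 := by
    rw [mul_eq_one_comm, ← Matrix.mul_assoc, hA, nonsing_inv_mul _ hdet]
  exact ⟨A, isUnit_det_of_right_inverse (B := Θ * Aᵀ) (by rwa [← Matrix.mul_assoc]), hA, h1⟩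

open scoped Matrix

theorem statement_7
    {X : Type*} [NormedAddCommGroup X] [InnerProductSpace ℝ X] [CompleteSpace X]
    [SecondCountableTopology X] [MeasurableSpace X] [BorelSpace X]
    {N M : ℕ}
    (μ : Measure X) [IsProbabilityMeasure μ] (hμ : IsCenteredGaussian μ)
    (K : X →L[ℝ] X)
    (hK : ∀ f g : X, ⟪K f, g⟫ = ∫ u, ⟪f, u⟫ * ⟪g, u⟫ ∂μ)
    (φ : Fin N → (X →L[ℝ] ℝ))
    -- the map `φ = (φ₁, …, φ_N) : X → ℝ^N`
    (Φ : X → EuclideanSpace ℝ (Fin N))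
    (hΦ : ∀ u i, Φ u i = φ i u)
    -- `θᵢ = K φᵢ*`, where `φᵢ*` is the Riesz representer of `φᵢ`
    (θ : Fin N → X)
    (hθ : ∀ i, θ i = K ((InnerProductSpace.toDual ℝ X).symm (φ i)))
    -- the Gram matrix `Θᵢⱼ = φᵢ(K φⱼ*)`, assumed invertible
    (Θ : Matrix (Fin N) (Fin N) ℝ)
    (hΘdef : ∀ i j, Θ i j = φ i (θ j))
    (hΘinv : IsUnit Θ.det)
    -- the gamblets `ϕᵢ = Σⱼ (Θ⁻¹)ᵢⱼ θⱼ` and the reconstruction map `ϕᵀ`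
    (ϕ : Fin N → X)
    (hϕ : ∀ i, ϕ i = ∑ j, Θ⁻¹ i j • θ j)
    (ϕT : EuclideanSpace ℝ (Fin N) → X)
    (hϕT : ∀ z, ϕT z = ∑ i, z i • ϕ i)
    -- `F` is locally Lipschitz
    (F : EuclideanSpace ℝ (Fin N) → EuclideanSpace ℝ (Fin M))
    (hF : ∀ r > (0 : ℝ), ∃ L : ℝ≥0, LipschitzOnWith L F (ball 0 r))
    (β : ℝ) (hβ : 0 < β) (y : EuclideanSpace ℝ (Fin M))
    -- the normalization constant `ω_β(y)` and the posterior `μ^y_β`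
    (ω : ℝ)
    (hω : ω = ∫ u, Real.exp (-‖F (Φ u) - y‖ ^ 2 / (2 * β ^ 2)) ∂μ)
    (post : Measure X)
    (hpost : post = μ.withDensity fun u =>
      ENNReal.ofReal (ω⁻¹ * Real.exp (-‖F (Φ u) - y‖ ^ 2 / (2 * β ^ 2))))
    -- `zdag` minimizes the finite-dimensional objective
    (zdag : EuclideanSpace ℝ (Fin N))
    (hzdag : ∀ z : EuclideanSpace ℝ (Fin N),
      1 / (2 * β ^ 2) * ‖F zdag - y‖ ^ 2 + (1 / 2) * ∑ i, ∑ j, zdag i * Θ⁻¹ i j * zdag j ≤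
      1 / (2 * β ^ 2) * ‖F z - y‖ ^ 2 + (1 / 2) * ∑ i, ∑ j, z i * Θ⁻¹ i j * z j) :
    IsMAP post (ϕT zdag) := by
  have hfK : ∀ f g : X →L[ℝ] ℝ,
      g (K ((InnerProductSpace.toDual ℝ X).symm f)) = ∫ u, f u * g u ∂μ := by
    intro f g
    rw [← InnerProductSpace.toDual_symm_apply (y := g), real_inner_comm, hK]
    simp_rw [InnerProductSpace.toDual_symm_apply]
  have hsum : ∀ (s : Fin N → ℝ) (f : X →L[ℝ] ℝ),
      ∫ u, (∑ j, s j • φ j) u * f u ∂μ = f (∑ j, s j • θ j) := by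
    intro s f
    rw [← hfK, map_sum, map_sum]
    simp [hθ]
  have hΘmul : ∀ s t : Fin N → ℝ,
      (∑ i, s i • φ i) (∑ j, t j • θ j) = s ⬝ᵥ Θ *ᵥ t := by
    intro s t
    simp only [Matrix.mulVec, dotProduct, map_sum, map_smul, smul_eq_mul, hΘdef,
      _root_.sum_apply, _root_.smul_apply, Finset.mul_sum]
    rw [Finset.sum_comm]
    exact Finset.sum_congr rfl fun i _ ↦ Finset.sum_congr rfl fun j _ ↦ by ring
  have hΘpos : Θ.PosSemidef := by
    refine .of_dotProduct_mulVec_nonneg ?_ fun x ↦ ?_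
    · ext i j
      simp only [Matrix.conjTranspose_apply, hΘdef, hθ, hfK, star_trivial]
      simp_rw [mul_comm]
    · rw [star_trivial, ← hΘmul, ← hsum]
      exact integral_nonneg fun u ↦ mul_self_nonneg _
  obtain ⟨A, hAdet, hAinv, hAΘ⟩ := hΘpos.exists_transpose_mul_self_eq_inv hΘinv
  set ψ : Fin N → X →L[ℝ] ℝ := fun i ↦ ∑ j, A i j • φ j
  set e : Fin N → X := fun i ↦ ∑ j, A i j • θ j
  have hψe : ∀ i j, ψ i (e j) = if i = j then 1 else 0 := by
    intro i j
    rw [hΘmul, ← Matrix.one_apply, ← hAΘ]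
    simp only [Matrix.mul_apply', Matrix.dotProduct_mulVec]
    rfl
  have hψ : ∀ u, ContinuousLinearMap.pi ψ u = A *ᵥ (Φ u).ofLp := by
    intro u
    ext i
    simp [ψ, Matrix.mulVec, dotProduct, hΦ]
  have hquad : ∀ z : EuclideanSpace ℝ (Fin N),
      ∑ i, ∑ j, z i * Θ⁻¹ i j * z j = ∑ i, (A *ᵥ z.ofLp) i ^ 2 := by
    intro z
    have h1 : ∑ i, ∑ j, z i * Θ⁻¹ i j * z j = z.ofLp ⬝ᵥ Θ⁻¹ *ᵥ z.ofLp := by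
      simp [Matrix.mulVec, dotProduct, Finset.mul_sum, mul_assoc]
    rw [h1, ← hAinv, ← Matrix.mulVec_mulVec, Matrix.dotProduct_mulVec, Matrix.vecMul_transpose]
    simp [dotProduct, sq]
  have hpoint : ϕT zdag = synthesis e (A *ᵥ zdag.ofLp) := by
    simp only [hϕT, hϕ, ← hAinv, synthesis_apply, e, Matrix.mulVec, dotProduct, Matrix.mul_apply,
      Matrix.transpose_apply, Finset.smul_sum, Finset.sum_smul, smul_smul]
    rw [Finset.sum_comm_cycle]
    refine Finset.sum_congr rfl fun k _ ↦ ?_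
    rw [Finset.sum_comm]
    refine Finset.sum_congr rfl fun j _ ↦ ?_
    rw [← Finset.sum_smul, Finset.sum_mul]
    exact congrArg (· • θ j) (Finset.sum_congr rfl fun i _ ↦ by ring)
  have hFc : Continuous F := by
    refine continuous_iff_continuousAt.2 fun z ↦ ?_
    obtain ⟨L, hL⟩ := hF (‖z‖ + 1) (by positivity)
    exact hL.continuousOn.continuousAt (isOpen_ball.mem_nhds (by simp))
  let G : (Fin N → ℝ) → ℝ := fun x ↦ ‖F (WithLp.toLp 2 (A⁻¹ *ᵥ x)) - y‖ ^ 2 / (2 * β ^ 2)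
  have hG : Continuous G := by fun_prop
  have hGz : ∀ z, G (A *ᵥ z.ofLp) = ‖F z - y‖ ^ 2 / (2 * β ^ 2) := by
    intro z
    simp [G, Matrix.nonsing_inv_mul A hAdet]
  have hω0 : 0 < ω := by
    have hΦG : ∀ u, Real.exp (-‖F (Φ u) - y‖ ^ 2 / (2 * β ^ 2)) =
        Real.exp (-G (ContinuousLinearMap.pi ψ u)) := fun u ↦ by rw [hψ, hGz, neg_div]
    rw [hω]
    simp_rw [hΦG]
    refine integral_exp_pos (.of_bound (by fun_prop) 1 (.of_forall fun u ↦ ?_))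
    rw [Real.norm_of_nonneg (by positivity), Real.exp_le_one_iff, neg_nonpos]
    positivity
  have hmin : ∀ x, G (A *ᵥ zdag.ofLp) + (∑ i, (A *ᵥ zdag.ofLp) i ^ 2) / 2 ≤
      G x + (∑ i, x i ^ 2) / 2 := by
    intro x
    have hx : A *ᵥ (WithLp.toLp 2 (A⁻¹ *ᵥ x) : EuclideanSpace ℝ (Fin N)).ofLp = x := by
      simp [Matrix.mul_nonsing_inv A hAdet]
    have := hzdag (WithLp.toLp 2 (A⁻¹ *ᵥ x))
    rw [hquad, hquad, hx] at this
    rw [hGz, ← hx, hGz, hx]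
    convert this using 1 <;> ring
  rw [hpost, hpoint]
  have := hμ.isMAP_withDensity hψe (fun i f ↦ hsum _ f) hG (fun x ↦ by positivity)
    (inv_pos.2 hω0) hmin
  simpa only [hψ, hGz, neg_div] using this

end
end
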